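/- Fix integers k ≥ 3 and 1 ≤ ℓ < k/2 and reals ε, d > 0 with d > 2ε, and let m > k²/(ε²(d−ε)). Suppose (V₁,…,V_k) is an (ε,d)-regular k-tuple in a k-uniform hypergraph with |V₁| = ⋯ = |V_{2ℓ}| = m and |V_{2ℓ+1}| = ⋯ = |V_k| = 2m. Then there are at most 2k/((d−ε)ε) pairwise vertex-disjoint ℓ-paths, each with all vertices in V₁ ∪ ⋯ ∪ V_k, that together cover all but at most 2kεm of the vertices of V₁ ∪ ⋯ ∪ V_k. -/

import Mathlib

open Finset

/-- Number of edges of `E` having exactly one vertex in each class of the tuple `W`. -/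
def eHyp {n k : ℕ} (E : Finset (Finset (Fin n))) (W : Fin k → Finset (Fin n)) : ℕ :=
  (E.filter fun e => ∀ i, (e ∩ W i).card = 1).card

/-- Density of `E` with respect to the tuple `W`. -/
noncomputable def densHyp {n k : ℕ} (E : Finset (Finset (Fin n)))
    (W : Fin k → Finset (Fin n)) : ℝ :=
  (eHyp E W : ℝ) / ∏ i, ((W i).card : ℝ)

/-- The tuple `W` is `(ε,d)`-regular w.r.t. the hypergraph `E`. -/
def RegularTuple {n k : ℕ} (ε d : ℝ) (E : Finset (Finset (Fin n)))
    (W : Fin k → Finset (Fin n)) : Prop :=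
  ∀ A : Fin k → Finset (Fin n), (∀ i, A i ⊆ W i) →
    (∀ i, ε * ((W i).card : ℝ) ≤ ((A i).card : ℝ)) →
    |densHyp E A - d| ≤ ε

/-- `vs` is (the vertex list of) an ℓ-path in the hypergraph `E`. -/
def IsPath {n : ℕ} (k l : ℕ) (E : Finset (Finset (Fin n))) (vs : List (Fin n)) : Prop :=
  vs.Nodup ∧ (∃ p : ℕ, 1 ≤ p ∧ vs.length = p * (k - l) + l) ∧
    ∀ i : ℕ, i * (k - l) + k ≤ vs.length →
      ((vs.drop (i * (k - l))).take k).toFinset ∈ E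

/-- A finite family that is large compared with its two projections has a nonempty subfamily in
which every fibre of either projection is large. -/
lemma exists_subset_large_fibres {α β γ : Type*} [DecidableEq β] [DecidableEq γ]
    (r : α → β) (r' : α → γ) {D : ℝ} (hD : 0 ≤ D) (F : Finset α)
    (h : D * ((F.image r).card + (F.image r').card) < F.card) :
    ∃ G ⊆ F, G.Nonempty ∧ (∀ f ∈ G, D < (G.filter fun g => r g = r f).card) ∧
      ∀ f ∈ G, D < (G.filter fun g => r' g = r' f).card := by
  classical
  induction F using Finset.strongInduction with
  | H F ih =>
    by_cases h1 : ∀ f ∈ F, D < (F.filter fun g => r g = r f).card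
    · by_cases h2 : ∀ f ∈ F, D < (F.filter fun g => r' g = r' f).card
      · refine ⟨F, subset_rfl, ?_, h1, h2⟩
        rw [← Finset.card_pos]
        have : (0 : ℝ) ≤ D * ((F.image r).card + (F.image r').card) := by positivity
        exact_mod_cast this.trans_lt h
      · push Not at h2
        obtain ⟨f, hf, hfD⟩ := h2
        have hlt : (F.filter fun g => ¬ r' g = r' f) ⊂ F :=
          Finset.filter_ssubset.2 ⟨f, hf, by simp⟩
        have hc := Finset.card_filter_add_card_filter_not (s := F) fun g => r' g = r' f
        have hi : ((F.filter fun g => ¬ r' g = r' f).image r).card ≤ (F.image r).card :=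
          Finset.card_le_card (Finset.image_subset_image hlt.subset)
        have hi' : ((F.filter fun g => ¬ r' g = r' f).image r').card + 1 ≤ (F.image r').card := by
          refine Finset.card_lt_card (Finset.ssubset_iff_of_subset
            (Finset.image_subset_image hlt.subset) |>.2
              ⟨r' f, Finset.mem_image_of_mem _ hf, ?_⟩)
          simp
        obtain ⟨G, hG, hG'⟩ := ih _ hlt (by
          have hc' : ((F.filter fun g => r' g = r' f).card : ℝ) +
              (F.filter fun g => ¬ r' g = r' f).card = F.card := by exact_mod_cast hc
          have hs : (((F.filter fun g => ¬ r' g = r' f).image r).card : ℝ) +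
              ((F.filter fun g => ¬ r' g = r' f).image r').card + 1 ≤
              (F.image r).card + (F.image r').card := by
            exact_mod_cast (by omega)
          nlinarith [mul_le_mul_of_nonneg_left hs hD])
        exact ⟨G, hG.trans hlt.subset, hG'⟩
    · push Not at h1
      obtain ⟨f, hf, hfD⟩ := h1
      have hlt : (F.filter fun g => ¬ r g = r f) ⊂ F :=
        Finset.filter_ssubset.2 ⟨f, hf, by simp⟩
      have hc := Finset.card_filter_add_card_filter_not (s := F) fun g => r g = r f
      have hi : ((F.filter fun g => ¬ r g = r f).image r').card ≤ (F.image r').card :=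
        Finset.card_le_card (Finset.image_subset_image hlt.subset)
      have hi' : ((F.filter fun g => ¬ r g = r f).image r).card + 1 ≤ (F.image r).card := by
        refine Finset.card_lt_card (Finset.ssubset_iff_of_subset
          (Finset.image_subset_image hlt.subset) |>.2
            ⟨r f, Finset.mem_image_of_mem _ hf, ?_⟩)
        simp
      obtain ⟨G, hG, hG'⟩ := ih _ hlt (by
        have hc' : ((F.filter fun g => r g = r f).card : ℝ) +
            (F.filter fun g => ¬ r g = r f).card = F.card := by exact_mod_cast hc
        have hs : (((F.filter fun g => ¬ r g = r f).image r).card : ℝ) +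
            ((F.filter fun g => ¬ r g = r f).image r').card + 1 ≤
            (F.image r).card + (F.image r').card := by
          exact_mod_cast (by omega)
        nlinarith [mul_le_mul_of_nonneg_left hs hD])
      exact ⟨G, hG.trans hlt.subset, hG'⟩

section Transversals

variable {ι V : Type*} [Fintype ι] [DecidableEq ι] [DecidableEq V]

lemma card_transversals_fixed_mul_le (A : ι → Finset V) (P : Finset ι) (g : ι → V) {i : ι}
    (hi : i ∈ Pᶜ) (v : V) :
    ((Fintype.piFinset A).filter fun h => (∀ j ∈ P, h j = g j) ∧ h i = v).card * (A i).card ≤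
      ∏ j ∈ Pᶜ, (A j).card := by
  let B : ι → Finset V := fun j => if j ∈ P then {g j} else if j = i then {v} else A j
  have hsub : ((Fintype.piFinset A).filter fun h => (∀ j ∈ P, h j = g j) ∧ h i = v) ⊆
      Fintype.piFinset B := by
    intro h hh
    simp only [Finset.mem_filter, Fintype.mem_piFinset] at hh ⊢
    intro j
    by_cases hj : j ∈ P
    · simp [B, hj, hh.2.1 j hj]
    · by_cases hji : j = i
      · subst hji
        simp [B, hj, hh.2.2]
      · simp [B, hj, hji, hh.1 j]
  have hprod : (Fintype.piFinset B).card = ∏ j ∈ Pᶜ.erase i, (A j).card := by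
    rw [Fintype.card_piFinset, ← Finset.prod_subset (Finset.subset_univ (Pᶜ.erase i))]
    · refine Finset.prod_congr rfl fun j hj => ?_
      simp only [Finset.mem_erase, Finset.mem_compl] at hj
      simp [B, hj.1, hj.2]
    · intro j _ hj
      simp only [Finset.mem_erase, Finset.mem_compl, not_and, not_not] at hj
      by_cases hjP : j ∈ P
      · simp [B, hjP]
      · have : j = i := by
          by_contra hne
          exact hjP (hj hne)
        subst this
        simp [B, hjP]
  calc _ ≤ (Fintype.piFinset B).card * (A i).card :=
        Nat.mul_le_mul_right _ (Finset.card_le_card hsub)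
    _ = _ := by rw [hprod, Finset.prod_erase_mul _ _ hi]

/-- Among many transversals agreeing with `g` on `P`, some one avoids a small set `S` outside of
`P`. -/
lemma exists_transversal_avoiding (A : ι → Finset V) (P : Finset ι) (g : ι → V)
    (G : Finset (ι → V)) (hG : G ⊆ Fintype.piFinset A) (S : Finset V) (a q : ℕ)
    (hS : ∀ i ∈ Pᶜ, a * (S ∩ A i).card ≤ q * (A i).card)
    (hdeg : Pᶜ.card * (q * ∏ j ∈ Pᶜ, (A j).card) <
      a * (G.filter fun h => ∀ j ∈ P, h j = g j).card) :
    ∃ h ∈ G, (∀ j ∈ P, h j = g j) ∧ ∀ j ∈ Pᶜ, h j ∉ S := by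
  by_contra! hcon
  refine hdeg.not_ge ?_
  let X : ι → V → Finset (ι → V) := fun i v =>
    (Fintype.piFinset A).filter fun h => (∀ j ∈ P, h j = g j) ∧ h i = v
  have hsub : (G.filter fun h => ∀ j ∈ P, h j = g j) ⊆
      Pᶜ.biUnion fun i => (S ∩ A i).biUnion fun v => X i v := by
    intro h hh
    rw [Finset.mem_filter] at hh
    obtain ⟨j, hj, hjS⟩ := hcon h hh.1 hh.2
    have hA := hG hh.1
    have hAj := Fintype.mem_piFinset.1 hA j
    simp only [Finset.mem_biUnion, Finset.mem_inter]
    exact ⟨j, hj, h j, ⟨hjS, hAj⟩, Finset.mem_filter.2 ⟨hA, hh.2, rfl⟩⟩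
  calc a * (G.filter fun h => ∀ j ∈ P, h j = g j).card
      ≤ a * ∑ i ∈ Pᶜ, ∑ v ∈ S ∩ A i, (X i v).card :=
        Nat.mul_le_mul_left _ ((Finset.card_le_card hsub).trans (Finset.card_biUnion_le.trans
          (Finset.sum_le_sum fun _ _ => Finset.card_biUnion_le)))
    _ = ∑ i ∈ Pᶜ, a * ∑ v ∈ S ∩ A i, (X i v).card := Finset.mul_sum _ _ _
    _ ≤ ∑ i ∈ Pᶜ, q * ∏ j ∈ Pᶜ, (A j).card := by
        refine Finset.sum_le_sum fun i hi => ?_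
        rcases (A i).card.eq_zero_or_pos with h0 | hpos
        · rw [Finset.card_eq_zero] at h0
          simp [h0]
        · refine Nat.le_of_mul_le_mul_right ?_ hpos
          calc a * (∑ v ∈ S ∩ A i, (X i v).card) * (A i).card
              = a * ∑ v ∈ S ∩ A i, (X i v).card * (A i).card := by
                rw [mul_assoc, Finset.sum_mul]
            _ ≤ a * ∑ v ∈ S ∩ A i, ∏ j ∈ Pᶜ, (A j).card :=
                Nat.mul_le_mul_left _ (Finset.sum_le_sum fun v _ =>
                  card_transversals_fixed_mul_le A P g hi v)
            _ = a * (S ∩ A i).card * ∏ j ∈ Pᶜ, (A j).card := by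
                rw [Finset.sum_const, smul_eq_mul, mul_assoc]
            _ ≤ q * (A i).card * ∏ j ∈ Pᶜ, (A j).card := Nat.mul_le_mul_right _ (hS i hi)
            _ = q * (∏ j ∈ Pᶜ, (A j).card) * (A i).card := by ring
    _ = Pᶜ.card * (q * ∏ j ∈ Pᶜ, (A j).card) := by rw [Finset.sum_const, smul_eq_mul]

lemma card_image_restrict_le (A : ι → Finset V) (P : Finset ι) (F : Finset (ι → V))
    (hF : F ⊆ Fintype.piFinset A) :
    (F.image fun f (i : P) => f i).card ≤ ∏ i ∈ P, (A i).card := by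
  rw [← Finset.prod_coe_sort P fun i => (A i).card, ← Fintype.card_piFinset]
  refine Finset.card_le_card fun f hf => ?_
  obtain ⟨f', hf', rfl⟩ := Finset.mem_image.1 hf
  exact Fintype.mem_piFinset.2 fun i => Fintype.mem_piFinset.1 (hF hf') i

end Transversals

lemma eHyp_le_card_transversals {n k : ℕ} (E : Finset (Finset (Fin n)))
    (hunif : ∀ e ∈ E, e.card = k) (A : Fin k → Finset (Fin n))
    (hdisj : ∀ i j, i ≠ j → Disjoint (A i) (A j)) :
    eHyp E A ≤ ((Fintype.piFinset A).filter fun f => Finset.univ.image f ∈ E).card := by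
  refine (Finset.card_le_card ?_).trans
    (Finset.card_image_le (f := fun f : Fin k → Fin n => Finset.univ.image f))
  intro e he
  obtain ⟨heE, he1⟩ := Finset.mem_filter.1 he
  choose f hf using fun i => Finset.card_eq_one.1 (he1 i)
  have hfm : ∀ i, f i ∈ e ∧ f i ∈ A i := fun i => by
    rw [← Finset.mem_inter, hf i]
    exact Finset.mem_singleton_self _
  have hinj : Function.Injective f := fun i j hij => by
    by_contra hne
    exact Finset.disjoint_left.1 (hdisj i j hne) (hfm i).2 (hij ▸ (hfm j).2)
  have himage : Finset.univ.image f = e := by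
    refine Finset.eq_of_subset_of_card_le ?_ ?_
    · intro v hv
      obtain ⟨i, -, rfl⟩ := Finset.mem_image.1 hv
      exact (hfm i).1
    · rw [Finset.card_image_of_injective _ hinj, hunif e heE, Finset.card_fin]
  exact Finset.mem_image.2 ⟨f, Finset.mem_filter.2
    ⟨Fintype.mem_piFinset.2 fun i => (hfm i).2, himage ▸ heE⟩, himage⟩

/-- `L` lists the vertices of an `l`-path with `t` edges that are transversals of `A`; consecutive
edges meet alternately in the classes indexed by `P` and by `Q`, and the last `l` vertices of `L`
are the values of `g` on `P`. -/
structure IsAlternatingPath {n : ℕ} (k l : ℕ) (E : Finset (Finset (Fin n)))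
    (A : Fin k → Finset (Fin n)) (P Q : Finset (Fin k)) (t : ℕ) (L : List (Fin n))
    (g : Fin k → Fin n) : Prop where
  nodup : L.Nodup
  length_eq : L.length = t * (k - l) + l
  edge_mem : ∀ i : ℕ, i * (k - l) + k ≤ L.length →
    ((L.drop (i * (k - l))).take k).toFinset ∈ E
  toFinset_drop : (L.drop (t * (k - l))).toFinset = P.image g
  subset : L.toFinset ⊆ Finset.univ.biUnion A
  card_left : ∀ i ∈ P, (L.toFinset ∩ A i).card = t / 2 + 1
  card_right : ∀ i ∈ Q, (L.toFinset ∩ A i).card = (t + 1) / 2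
  card_mid : ∀ i ∈ (P ∪ Q)ᶜ, (L.toFinset ∩ A i).card = t

section AlternatingPaths

variable {n k l : ℕ} {E : Finset (Finset (Fin n))} {A : Fin k → Finset (Fin n)}
  {P Q : Finset (Fin k)}

lemma eq_of_transversal_mem (hdisj : ∀ i j, i ≠ j → Disjoint (A i) (A j))
    {h : Fin k → Fin n} (hh : h ∈ Fintype.piFinset A) {i j : Fin k} (hij : h j ∈ A i) : j = i := by
  by_contra hne
  exact Finset.disjoint_left.1 (hdisj j i hne) (Fintype.mem_piFinset.1 hh j) hij

lemma transversal_injective (hdisj : ∀ i j, i ≠ j → Disjoint (A i) (A j))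
    {h : Fin k → Fin n} (hh : h ∈ Fintype.piFinset A) : Function.Injective h := fun _ j hij =>
  eq_of_transversal_mem hdisj hh (hij ▸ Fintype.mem_piFinset.1 hh j)

lemma image_transversal_inter (hdisj : ∀ i j, i ≠ j → Disjoint (A i) (A j))
    {h : Fin k → Fin n} (hh : h ∈ Fintype.piFinset A) (S : Finset (Fin k)) (i : Fin k) :
    S.image h ∩ A i = if i ∈ S then {h i} else ∅ := by
  ext v
  simp only [Finset.mem_inter, Finset.mem_image]
  constructor
  · rintro ⟨⟨j, hj, rfl⟩, hv⟩
    obtain rfl := eq_of_transversal_mem hdisj hh hv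
    simp [hj]
  · intro hv
    split_ifs at hv with hi
    · rw [Finset.mem_singleton] at hv
      subst hv
      exact ⟨⟨i, hi, rfl⟩, Fintype.mem_piFinset.1 hh i⟩
    · simp at hv

lemma IsAlternatingPath.single (hdisj : ∀ i j, i ≠ j → Disjoint (A i) (A j))
    (hP : P.card = l) (hPQ : Disjoint P Q) (hlk : l < k) {g : Fin k → Fin n}
    (hg : g ∈ Fintype.piFinset A) :
    IsAlternatingPath k l E A P Q 0 (P.toList.map g) g := by
  have hinj := transversal_injective hdisj hg
  have hset : (P.toList.map g).toFinset = P.image g := by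
    ext v; simp
  constructor
  · exact P.nodup_toList.map hinj
  · simp [hP]
  · intro i hi
    simp only [List.length_map, Finset.length_toList, hP] at hi
    exact absurd hi (by omega)
  · simpa using hset
  · rw [hset]
    intro v hv
    obtain ⟨i, -, rfl⟩ := Finset.mem_image.1 hv
    exact Finset.mem_biUnion.2 ⟨i, Finset.mem_univ _, Fintype.mem_piFinset.1 hg i⟩
  · intro i hi
    rw [hset, image_transversal_inter hdisj hg, if_pos hi]
    simp
  · intro i hi
    rw [hset, image_transversal_inter hdisj hg,
      if_neg (Finset.disjoint_right.1 hPQ hi)]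
    simp
  · intro i hi
    rw [hset, image_transversal_inter hdisj hg, if_neg (by simp at hi; exact hi.1)]
    simp

lemma IsAlternatingPath.extend (hdisj : ∀ i j, i ≠ j → Disjoint (A i) (A j))
    (hP : P.card = l) (hQ : Q.card = l) (hPQ : Disjoint P Q) (hlk : 2 * l < k)
    {t : ℕ} {L : List (Fin n)} {g h : Fin k → Fin n}
    (hL : IsAlternatingPath k l E A P Q t L g) (hh : h ∈ Fintype.piFinset A)
    (hE : Finset.univ.image h ∈ E) (hgh : ∀ j ∈ P, h j = g j)
    (havoid : ∀ j ∈ Pᶜ, h j ∉ L.toFinset) :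
    IsAlternatingPath k l E A Q P (t + 1)
      (L ++ ((P ∪ Q)ᶜ.toList.map h ++ Q.toList.map h)) h := by
  have hinj := transversal_injective hdisj hh
  have hQc : Q ⊆ Pᶜ := fun i hi => Finset.mem_compl.2 (Finset.disjoint_right.1 hPQ hi)
  have hset : ((P ∪ Q)ᶜ.toList.map h ++ Q.toList.map h).toFinset = Pᶜ.image h := by
    ext v
    simp only [List.toFinset_append, Finset.mem_union, List.mem_toFinset, List.mem_map,
      Finset.mem_toList, Finset.mem_compl, Finset.mem_image]
    constructor
    · rintro (⟨i, hi, rfl⟩ | ⟨i, hi, rfl⟩)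
      · exact ⟨i, fun h => hi (Or.inl h), rfl⟩
      · exact ⟨i, Finset.mem_compl.1 (hQc hi), rfl⟩
    · rintro ⟨i, hi, rfl⟩
      by_cases hiQ : i ∈ Q
      · exact Or.inr ⟨i, hiQ, rfl⟩
      · exact Or.inl ⟨i, fun h => h.elim hi hiQ, rfl⟩
  have hcardM : (P ∪ Q)ᶜ.card = k - 2 * l := by
    rw [Finset.card_compl, Finset.card_union_of_disjoint hPQ, hP, hQ, Fintype.card_fin, two_mul]
  have hlen' : ((P ∪ Q)ᶜ.toList.map h ++ Q.toList.map h).length = k - l := by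
    simp only [List.length_append, List.length_map, Finset.length_toList, hcardM, hQ]
    omega
  have hLlen := hL.length_eq
  have hlen : (L ++ ((P ∪ Q)ᶜ.toList.map h ++ Q.toList.map h)).length = (t + 1) * (k - l) + l := by
    rw [List.length_append, hlen', hL.length_eq, add_mul]
    omega
  have hcount : ∀ i, ((L ++ ((P ∪ Q)ᶜ.toList.map h ++ Q.toList.map h)).toFinset ∩ A i).card =
      (L.toFinset ∩ A i).card + if i ∈ Pᶜ then 1 else 0 := by
    intro i
    rw [List.toFinset_append, hset, Finset.union_inter_distrib_right,
      image_transversal_inter hdisj hh]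
    split_ifs with hi
    · rw [Finset.card_union_of_disjoint, Finset.card_singleton]
      rw [Finset.disjoint_singleton_right]
      exact fun hmem => havoid i hi (Finset.mem_inter.1 hmem).1
    · simp
  constructor
  · rw [List.nodup_append']
    refine ⟨hL.nodup, ?_, ?_⟩
    · rw [← List.map_append]
      refine List.Nodup.map hinj ?_
      rw [List.nodup_append']
      refine ⟨Finset.nodup_toList _, Finset.nodup_toList _, ?_⟩
      intro i hi hi'
      simp only [Finset.mem_toList, Finset.mem_compl, Finset.mem_union, not_or] at hi hi'
      exact hi.2 hi'
    · intro v hv hv'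
      rw [← List.mem_toFinset, hset] at hv'
      obtain ⟨i, hi, rfl⟩ := Finset.mem_image.1 hv'
      exact havoid i hi (List.mem_toFinset.2 hv)
  · exact hlen
  · intro i hi
    rw [hlen] at hi
    have hit : i ≤ t := by
      by_contra! hti
      have := Nat.mul_le_mul_right (k - l) (show t + 1 ≤ i from hti)
      omega
    rcases hit.lt_or_eq with hlt | rfl
    · have := Nat.mul_le_mul_right (k - l) (show i + 1 ≤ t from hlt)
      rw [add_mul] at this
      have hle : i * (k - l) + k ≤ L.length := by omega
      rw [List.drop_append_of_le_length (by omega), List.take_append_of_le_length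
        (by rw [List.length_drop]; omega)]
      exact hL.edge_mem i hle
    · rw [List.drop_append_of_le_length (by omega), List.take_of_length_le
        (by rw [List.length_append, hlen', List.length_drop]; omega),
        List.toFinset_append, hset, hL.toFinset_drop,
        ← Finset.image_congr (f := h) (fun j hj => hgh j hj), ← Finset.image_union,
        Finset.union_compl]
      exact hE
  · have hd : (t + 1) * (k - l) = (L ++ (P ∪ Q)ᶜ.toList.map h).length := by
      rw [List.length_append, List.length_map, Finset.length_toList, hcardM, hLlen, add_mul]
      omega
    rw [← List.append_assoc, hd, List.drop_left]
    ext v; simp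
  · rw [List.toFinset_append, hset]
    refine Finset.union_subset hL.subset fun v hv => ?_
    obtain ⟨i, -, rfl⟩ := Finset.mem_image.1 hv
    exact Finset.mem_biUnion.2 ⟨i, Finset.mem_univ _, Fintype.mem_piFinset.1 hh i⟩
  · intro i hi
    rw [hcount, if_pos (hQc hi), hL.card_right i hi]
  · intro i hi
    rw [hcount, if_neg (by simpa using hi), hL.card_left i hi]
    omega
  · intro i hi
    rw [Finset.union_comm] at hi
    rw [hcount, if_pos (by simp at hi ⊢; exact hi.1), hL.card_mid i hi]

lemma IsAlternatingPath.exists_extension (hdisj : ∀ i j, i ≠ j → Disjoint (A i) (A j))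
    (hP : P.card = l) (hQ : Q.card = l) (hPQ : Disjoint P Q) (hlk : 2 * l < k)
    {a q : ℕ} (hAQ : ∀ i ∈ Q, (A i).card = a) (hAM : ∀ i ∈ (P ∪ Q)ᶜ, 2 * a ≤ (A i).card)
    {G : Finset (Fin k → Fin n)} (hG : G ⊆ Fintype.piFinset A)
    (hGE : ∀ f ∈ G, Finset.univ.image f ∈ E)
    {t : ℕ} (ht : t ≤ 2 * q) {L : List (Fin n)} {g : Fin k → Fin n}
    (hL : IsAlternatingPath k l E A P Q t L g)
    (hdeg : (k - l) * (q * ∏ j ∈ Pᶜ, (A j).card) <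
      a * (G.filter fun h => ∀ j ∈ P, h j = g j).card) :
    ∃ L', ∃ h ∈ G, IsAlternatingPath k l E A Q P (t + 1) L' h := by
  obtain ⟨h, hhG, hgh, havoid⟩ := exists_transversal_avoiding A P g G hG L.toFinset a q
    (by
      intro i hi
      by_cases hiQ : i ∈ Q
      · rw [hL.card_right i hiQ, hAQ i hiQ, mul_comm]
        exact Nat.mul_le_mul_right _ (by omega)
      · have hiM : i ∈ (P ∪ Q)ᶜ := by
          simp only [Finset.mem_compl, Finset.mem_union, not_or] at hi ⊢
          exact ⟨hi, hiQ⟩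
        rw [hL.card_mid i hiM]
        calc a * t ≤ a * (2 * q) := Nat.mul_le_mul_left _ ht
          _ = q * (2 * a) := by ring
          _ ≤ _ := Nat.mul_le_mul_left _ (hAM i hiM))
    (by rw [Finset.card_compl, hP, Fintype.card_fin]; convert hdeg)
  exact ⟨_, h, hhG, hL.extend hdisj hP hQ hPQ hlk (hG hhG) (hGE h hhG) hgh havoid⟩

end AlternatingPaths

lemma exists_path_of_density {n k l : ℕ} (hl1 : 1 ≤ l) (hl2 : 2 * l < k)
    {E : Finset (Finset (Fin n))} (hunif : ∀ e ∈ E, e.card = k)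
    {A : Fin k → Finset (Fin n)} (hdisj : ∀ i j, i ≠ j → Disjoint (A i) (A j))
    {a q : ℕ} (ha : 0 < a) (hA : ∀ i : Fin k, (i : ℕ) < 2 * l → (A i).card = a)
    (hA' : ∀ i : Fin k, ¬ (i : ℕ) < 2 * l → 2 * a ≤ (A i).card)
    {δ : ℝ} (hδ : 0 < δ) (hdens : δ ≤ densHyp E A) (hq : 2 * k * q ≤ δ * a) :
    ∃ L : List (Fin n), IsPath k l E L ∧ L.toFinset ⊆ Finset.univ.biUnion A ∧
      (∀ i : Fin k, (i : ℕ) < 2 * l → (L.toFinset ∩ A i).card = q + 1) ∧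
      ∀ i : Fin k, ¬ (i : ℕ) < 2 * l → (L.toFinset ∩ A i).card = 2 * q + 1 := by
  let P : Finset (Fin k) := Finset.univ.filter fun i => (i : ℕ) < l
  let Q : Finset (Fin k) := Finset.univ.filter fun i => l ≤ (i : ℕ) ∧ (i : ℕ) < 2 * l
  have hPQ : Disjoint P Q := by
    rw [Finset.disjoint_left]
    intro i hi hi'
    simp only [P, Q, Finset.mem_filter, Finset.mem_univ, true_and] at hi hi'
    omega
  have hunion : ∀ i, i ∈ P ∪ Q ↔ (i : ℕ) < 2 * l := by
    intro i
    simp only [P, Q, Finset.mem_union, Finset.mem_filter, Finset.mem_univ, true_and]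
    omega
  have hP : P.card = l := by
    rw [Fin.card_filter_val_lt, min_eq_right (by omega)]
  have hPQcard : (P ∪ Q).card = 2 * l := by
    have : P ∪ Q = Finset.univ.filter fun i : Fin k => (i : ℕ) < 2 * l := by
      ext i; simp [hunion]
    rw [this, Fin.card_filter_val_lt, min_eq_right (by omega)]
  have hQ : Q.card = l := by
    rw [Finset.card_union_of_disjoint hPQ] at hPQcard
    omega
  have hAP : ∀ i ∈ P, (A i).card = a := fun i hi =>
    hA i ((hunion i).1 (Finset.mem_union_left _ hi))
  have hAQ : ∀ i ∈ Q, (A i).card = a := fun i hi =>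
    hA i ((hunion i).1 (Finset.mem_union_right _ hi))
  have hAM : ∀ i ∈ (P ∪ Q)ᶜ, 2 * a ≤ (A i).card := fun i hi =>
    hA' i fun h => Finset.mem_compl.1 hi ((hunion i).2 h)
  obtain ⟨M, hM⟩ : ∃ M, ∏ j ∈ (P ∪ Q)ᶜ, (A j).card = M := ⟨_, rfl⟩
  have hMpos : 0 < M := hM ▸ Finset.prod_pos fun i hi => by have := hAM i hi; omega
  have hprodP : ∏ j ∈ P, (A j).card = a ^ l := by
    rw [Finset.prod_congr rfl hAP, Finset.prod_const, hP]
  have hprodQ : ∏ j ∈ Q, (A j).card = a ^ l := by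
    rw [Finset.prod_congr rfl hAQ, Finset.prod_const, hQ]
  have hprod : ∏ j, (A j).card = a ^ l * (a ^ l * M) := by
    rw [← Finset.prod_mul_prod_compl (P ∪ Q), Finset.prod_union hPQ, hprodP, hprodQ, hM, mul_assoc]
  have hapos : 0 < a ^ l := pow_pos ha l
  have hprodPc : ∏ j ∈ Pᶜ, (A j).card = a ^ l * M := by
    refine Nat.eq_of_mul_eq_mul_left hapos ?_
    rw [← hprod, ← Finset.prod_mul_prod_compl P, hprodP]
  have hprodQc : ∏ j ∈ Qᶜ, (A j).card = a ^ l * M := by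
    refine Nat.eq_of_mul_eq_mul_left hapos ?_
    rw [← hprod, ← Finset.prod_mul_prod_compl Q, hprodQ]
  let F := (Fintype.piFinset A).filter fun f => Finset.univ.image f ∈ E
  have hFcard : δ * ((a : ℝ) ^ l * (a ^ l * M)) ≤ F.card := by
    have h1 : (eHyp E A : ℝ) ≤ F.card := by
      exact_mod_cast eHyp_le_card_transversals E hunif A hdisj
    have h2 : ∏ i, ((A i).card : ℝ) = (a : ℝ) ^ l * (a ^ l * M) := by exact_mod_cast hprod
    rw [densHyp, h2, le_div_iff₀ (by positivity)] at hdens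
    exact hdens.trans h1
  obtain ⟨D, hD⟩ : ∃ D : ℝ, D = ((k - l : ℕ) * (q * (a ^ l * M))) / a := ⟨_, rfl⟩
  have hD0 : 0 ≤ D := hD ▸ by positivity
  have hFsub : F ⊆ Fintype.piFinset A := Finset.filter_subset _ _
  obtain ⟨G, hGF, ⟨g₀, hg₀⟩, hGP, hGQ⟩ := exists_subset_large_fibres
    (fun (f : Fin k → Fin n) (i : P) => f i) (fun (f : Fin k → Fin n) (i : Q) => f i)
    hD0 F (by
      have h1 := card_image_restrict_le A P F hFsub
      have h2 := card_image_restrict_le A Q F hFsub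
      rw [hprodP] at h1
      rw [hprodQ] at h2
      have h3 : (((F.image fun (f : Fin k → Fin n) (i : P) => f i).card : ℝ) +
          (F.image fun (f : Fin k → Fin n) (i : Q) => f i).card) ≤ 2 * a ^ l := by
        exact_mod_cast (by omega)
      have h4 : 2 * ((k - l : ℕ) : ℝ) * q < δ * a := by
        rcases q.eq_zero_or_pos with rfl | hqpos
        · simp; positivity
        · refine lt_of_lt_of_le ?_ hq
          have : ((k - l : ℕ) : ℝ) < k := by exact_mod_cast (by omega)
          gcongr
      refine (mul_le_mul_of_nonneg_left h3 (by positivity)).trans_lt (lt_of_lt_of_le ?_ hFcard)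
      have h5 : (0 : ℝ) < a ^ l * (a ^ l * M) / a := by positivity
      calc D * (2 * a ^ l)
          = 2 * ((k - l : ℕ) : ℝ) * q * (a ^ l * (a ^ l * M) / a) := by rw [hD]; ring
        _ < δ * a * (a ^ l * (a ^ l * M) / a) := mul_lt_mul_of_pos_right h4 h5
        _ = δ * ((a : ℝ) ^ l * (a ^ l * M)) := by field_simp)
  have hG : G ⊆ Fintype.piFinset A := hGF.trans hFsub
  have hGE : ∀ f ∈ G, Finset.univ.image f ∈ E := fun f hf => (Finset.mem_filter.1 (hGF hf)).2
  have hdegP : ∀ g ∈ G, (k - l) * (q * ∏ j ∈ Pᶜ, (A j).card) <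
      a * (G.filter fun h => ∀ j ∈ P, h j = g j).card := by
    intro g hg
    have h1 := hGP g hg
    simp only [funext_iff, Subtype.forall] at h1
    rw [hD, div_lt_iff₀ (by positivity), mul_comm _ (a : ℝ)] at h1
    rw [hprodPc]
    exact_mod_cast h1
  have hdegQ : ∀ g ∈ G, (k - l) * (q * ∏ j ∈ Qᶜ, (A j).card) <
      a * (G.filter fun h => ∀ j ∈ Q, h j = g j).card := by
    intro g hg
    have h1 := hGQ g hg
    simp only [funext_iff, Subtype.forall] at h1
    rw [hD, div_lt_iff₀ (by positivity), mul_comm _ (a : ℝ)] at h1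
    rw [hprodQc]
    exact_mod_cast h1
  have hpaths : ∀ t ≤ 2 * q + 1,
      (∃ L, ∃ g ∈ G, IsAlternatingPath k l E A P Q t L g) ∨
        ∃ L, ∃ g ∈ G, IsAlternatingPath k l E A Q P t L g := by
    intro t
    induction t with
    | zero =>
      exact fun _ => Or.inl ⟨_, g₀, hg₀, .single hdisj hP hPQ (by omega) (hG hg₀)⟩
    | succ t ih =>
      intro ht
      rcases ih (by omega) with ⟨L, g, hg, hL⟩ | ⟨L, g, hg, hL⟩
      · exact Or.inr (hL.exists_extension hdisj hP hQ hPQ hl2 hAQ hAM hG hGE (by omega)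
          (hdegP g hg))
      · exact Or.inl (hL.exists_extension hdisj hQ hP hPQ.symm hl2 hAP
          (by rwa [Finset.union_comm]) hG hGE (by omega) (hdegQ g hg))
  rcases hpaths _ le_rfl with ⟨L, g, -, hL⟩ | ⟨L, g, -, hL⟩
  · refine ⟨L, ⟨hL.nodup, ⟨_, by omega, hL.length_eq⟩, hL.edge_mem⟩, hL.subset, ?_, ?_⟩
    · intro i hi
      rcases Finset.mem_union.1 ((hunion i).2 hi) with h | h
      · rw [hL.card_left i h]; omega
      · rw [hL.card_right i h]; omega
    · intro i hi
      exact hL.card_mid i (by rwa [Finset.mem_compl, hunion])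
  · refine ⟨L, ⟨hL.nodup, ⟨_, by omega, hL.length_eq⟩, hL.edge_mem⟩, hL.subset, ?_, ?_⟩
    · intro i hi
      rcases Finset.mem_union.1 ((hunion i).2 hi) with h | h
      · rw [hL.card_right i h]; omega
      · rw [hL.card_left i h]; omega
    · intro i hi
      exact hL.card_mid i (by rwa [Finset.mem_compl, Finset.union_comm, hunion])

/-- Disjoint paths can be removed greedily as long as the classes remain large. -/
lemma exists_disjoint_paths {n k l : ℕ} (hl1 : 1 ≤ l) (hl2 : 2 * l < k)
    {ε d : ℝ} (hε : 0 < ε) (hd : ε < d) {m q : ℕ} (hmpos : 0 < m)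
    {E : Finset (Finset (Fin n))} (hunif : ∀ e ∈ E, e.card = k)
    {W : Fin k → Finset (Fin n)} (hdisj : ∀ i j, i ≠ j → Disjoint (W i) (W j))
    (hcard : ∀ i : Fin k, (W i).card = if (i : ℕ) < 2 * l then m else 2 * m)
    (hreg : RegularTuple ε d E W) (hq : 2 * k * q ≤ (d - ε) * (ε * m)) (j : ℕ)
    (hj : ∀ j' < j, ε * m + j' * (q + 1 : ℕ) ≤ m) :
    ∃ T : ℕ → List (Fin n), (∀ i < j, IsPath k l E (T i)) ∧
      (∀ i < j, (T i).toFinset ⊆ Finset.univ.biUnion W) ∧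
      (∀ i < j, ∀ i' < j, i ≠ i' → Disjoint (T i).toFinset (T i').toFinset) ∧
      (∀ c : Fin k, (c : ℕ) < 2 * l →
        ((W c).filter fun v => ∀ i < j, v ∉ T i).card + j * (q + 1) = m) ∧
      ∀ c : Fin k, ¬ (c : ℕ) < 2 * l →
        ((W c).filter fun v => ∀ i < j, v ∉ T i).card + j * (2 * q + 1) = 2 * m := by
  induction j with
  | zero =>
    refine ⟨fun _ => [], by simp, by simp, by simp, ?_, ?_⟩
    · intro c hc
      simp [hcard c, hc]
    · intro c hc
      simp only [hcard c, hc, if_false, Nat.not_lt_zero, false_imp_iff, implies_true,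
        Finset.filter_true, zero_mul, add_zero]
  | succ j ih =>
    obtain ⟨T, hT, hTW, hTd, hc1, hc2⟩ := ih fun j' hj' => hj j' (by omega)
    have hjj := hj j (by omega)
    let A : Fin k → Finset (Fin n) := fun c => (W c).filter fun v => ∀ i < j, v ∉ T i
    have hAW : ∀ c, A c ⊆ W c := fun c => Finset.filter_subset _ _
    let c₀ : Fin k := ⟨0, by omega⟩
    have hc₀ : (A c₀).card + j * (q + 1) = m := hc1 c₀ (by simp only [c₀]; omega)
    set a := (A c₀).card with ha
    have haε : ε * m ≤ a := by
      have : (a : ℝ) + j * (q + 1 : ℕ) = m := by exact_mod_cast hc₀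
      linarith
    have hapos : 0 < a := by
      have : (0 : ℝ) < a := lt_of_lt_of_le (by positivity) haε
      exact_mod_cast this
    have hA : ∀ c : Fin k, (c : ℕ) < 2 * l → (A c).card = a := fun c hc => by
      have : (A c).card + j * (q + 1) = m := hc1 c hc
      omega
    have hA' : ∀ c : Fin k, ¬ (c : ℕ) < 2 * l → 2 * a ≤ (A c).card := fun c hc => by
      have : (A c).card + j * (2 * q + 1) = 2 * m := hc2 c hc
      nlinarith
    have hdens : d - ε ≤ densHyp E A := by
      have := hreg A hAW fun c => by
        rw [hcard c]
        split_ifs with hc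
        · rw [hA c hc]; exact haε
        · have h2 : ((2 * a : ℕ) : ℝ) ≤ (A c).card := by exact_mod_cast hA' c hc
          push_cast at h2 ⊢
          linarith
      linarith [(abs_le.1 this).1]
    obtain ⟨L, hL, hLA, hL1, hL2⟩ := exists_path_of_density hl1 hl2 hunif
      (fun i i' hi => Finset.disjoint_of_subset_left (hAW i)
        (Finset.disjoint_of_subset_right (hAW i') (hdisj i i' hi)))
      hapos hA hA' (sub_pos.2 hd) hdens
      (hq.trans (mul_le_mul_of_nonneg_left haε (sub_pos.2 hd).le))
    have hLT : ∀ i < j, Disjoint (T i).toFinset L.toFinset := by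
      intro i hi
      rw [Finset.disjoint_left]
      intro v hv hvL
      obtain ⟨c, -, hvc⟩ := Finset.mem_biUnion.1 (hLA hvL)
      exact (Finset.mem_filter.1 hvc).2 i hi (List.mem_toFinset.1 hv)
    have hTj : ∀ i < j, Function.update T j L i = T i := fun i hi =>
      Function.update_of_ne hi.ne _ _
    have hTjj : Function.update T j L j = L := Function.update_self _ _ _
    have hfilter : ∀ c, ((W c).filter fun v => ∀ i < j + 1, v ∉ Function.update T j L i).card +
        (L.toFinset ∩ A c).card = (A c).card := by
      intro c
      rw [Finset.inter_comm, ← Finset.card_sdiff_add_card_inter (A c) L.toFinset]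
      congr 2
      ext v
      simp only [A, Finset.mem_filter, Finset.mem_sdiff, List.mem_toFinset]
      constructor
      · rintro ⟨hv, h⟩
        exact ⟨⟨hv, fun i hi => hTj i hi ▸ h i (by omega)⟩, hTjj ▸ h j (by omega)⟩
      · rintro ⟨⟨hv, h⟩, hvL⟩
        refine ⟨hv, fun i hi => ?_⟩
        rcases Nat.lt_succ_iff_lt_or_eq.1 hi with hi | rfl
        · exact hTj i hi ▸ h i hi
        · rwa [hTjj]
    refine ⟨Function.update T j L, ?_, ?_, ?_, ?_, ?_⟩
    · intro i hi
      rcases Nat.lt_succ_iff_lt_or_eq.1 hi with hi | rfl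
      · exact (hTj i hi).symm ▸ hT i hi
      · rwa [hTjj]
    · intro i hi
      rcases Nat.lt_succ_iff_lt_or_eq.1 hi with hi | rfl
      · exact (hTj i hi).symm ▸ hTW i hi
      · rw [hTjj]
        exact hLA.trans (Finset.biUnion_mono fun c _ => hAW c)
    · intro i hi i' hi' hne
      rcases Nat.lt_succ_iff_lt_or_eq.1 hi with hi | rfl <;>
        rcases Nat.lt_succ_iff_lt_or_eq.1 hi' with hi' | rfl
      · rw [hTj i hi, hTj i' hi']
        exact hTd i hi i' hi' hne
      · rw [hTj i hi, hTjj]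
        exact hLT i hi
      · rw [hTj i' hi', hTjj]
        exact (hLT i' hi').symm
      · exact absurd rfl hne
    · intro c hc
      have h1 := hfilter c
      have h2 : (A c).card + j * (q + 1) = m := hc1 c hc
      rw [hL1 c hc] at h1
      rw [add_mul]
      omega
    · intro c hc
      have h1 := hfilter c
      have h2 : (A c).card + j * (2 * q + 1) = 2 * m := hc2 c hc
      rw [hL2 c hc] at h1
      rw [add_mul]
      omega

theorem stmt17 (k l : ℕ) (hk : 3 ≤ k) (hl1 : 1 ≤ l) (hl2 : 2 * l < k)
    (ε d : ℝ) (hε : 0 < ε) (hd : 2 * ε < d)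
    (m : ℕ) (hm : (k : ℝ) ^ 2 / (ε ^ 2 * (d - ε)) < (m : ℝ)) {n : ℕ}
    (E : Finset (Finset (Fin n))) (hunif : ∀ e ∈ E, e.card = k)
    (W : Fin k → Finset (Fin n))
    (hdisj : ∀ i j, i ≠ j → Disjoint (W i) (W j))
    (hcard : ∀ i : Fin k, (W i).card = if (i : ℕ) < 2 * l then m else 2 * m)
    (hreg : RegularTuple ε d E W) :
    ∃ (j : ℕ) (T : Fin j → List (Fin n)),
      ((j : ℝ) ≤ 2 * k / ((d - ε) * ε)) ∧
      (∀ i, IsPath k l E (T i)) ∧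
      (∀ i, (T i).toFinset ⊆ Finset.univ.biUnion W) ∧
      (∀ i i', i ≠ i' → Disjoint (T i).toFinset (T i').toFinset) ∧
      ((((Finset.univ.biUnion W).filter fun v => ∀ i, v ∉ T i).card : ℝ) ≤
        2 * k * ε * m) := by
  have hδ : 0 < d - ε := by linarith
  have hkpos : (0 : ℝ) < k := by exact_mod_cast (by omega)
  have hmR : (0 : ℝ) < m := lt_of_le_of_lt (by positivity) hm
  have hmpos : 0 < m := by exact_mod_cast hmR
  set x : ℝ := (d - ε) * (ε * m) / (2 * k) with hx
  set q : ℕ := ⌊x⌋₊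
  have hq : 2 * k * q ≤ (d - ε) * (ε * m) := by
    have h := Nat.floor_le (show 0 ≤ x by positivity)
    rw [hx, le_div_iff₀ (by positivity)] at h
    linarith
  have hxq : x < (q + 1 : ℕ) := by
    push_cast
    exact Nat.lt_floor_add_one x
  have hex : ∃ j : ℕ, (m : ℝ) < ε * m + j * (q + 1 : ℕ) := by
    refine ⟨m, ?_⟩
    have h1 : (1 : ℝ) ≤ (q + 1 : ℕ) := by exact_mod_cast (by omega)
    nlinarith [mul_pos hε hmR]
  classical
  obtain ⟨T, hT, hTW, hTd, hc1, hc2⟩ := exists_disjoint_paths hl1 hl2 hε (by linarith) hmpos hunif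
    hdisj hcard hreg hq (Nat.find hex) fun j' hj' => not_lt.1 (Nat.find_min hex hj')
  have hj := Nat.find_spec hex
  set j := Nat.find hex
  have hjle : (j : ℝ) ≤ 2 * k / ((d - ε) * ε) := by
    have h1 : (j : ℝ) * (q + 1 : ℕ) ≤ m := by
      have := hc1 ⟨0, by omega⟩ (by simp only; omega)
      exact_mod_cast (by omega : j * (q + 1) ≤ m)
    have h2 : (j : ℝ) * x ≤ m :=
      (mul_le_mul_of_nonneg_left hxq.le (Nat.cast_nonneg _)).trans h1
    rw [hx, mul_div_assoc', div_le_iff₀ (by positivity)] at h2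
    rw [le_div_iff₀ (by positivity)]
    refine le_of_mul_le_mul_right ?_ hmR
    linarith
  refine ⟨j, fun i => T i, hjle, fun i => hT i i.2, fun i => hTW i i.2,
    fun i i' hne => hTd i i.2 i' i'.2 fun h => hne (Fin.ext h), ?_⟩
  have hkj : (k : ℝ) * j ≤ 2 * (ε * m) := by
    rw [div_lt_iff₀ (by positivity)] at hm
    rw [le_div_iff₀ (by positivity)] at hjle
    have h1 : (k : ℝ) * j * ((d - ε) * ε) ≤ 2 * (ε * m) * ((d - ε) * ε) := by
      nlinarith [mul_le_mul_of_nonneg_left hjle hkpos.le]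
    exact le_of_mul_le_mul_right h1 (by positivity)
  have hsub : ((Finset.univ.biUnion W).filter fun v => ∀ i : Fin j, v ∉ T i) ⊆
      Finset.univ.biUnion fun c => (W c).filter fun v => ∀ i < j, v ∉ T i := by
    intro v hv
    simp only [Finset.mem_filter, Finset.mem_biUnion, Finset.mem_univ, true_and] at hv ⊢
    obtain ⟨⟨c, hc⟩, h⟩ := hv
    exact ⟨c, hc, fun i hi => h ⟨i, hi⟩⟩
  have hbound : ∀ c : Fin k, (((W c).filter fun v => ∀ i < j, v ∉ T i).card : ℝ) ≤
      2 * (ε * m) + j - if (c : ℕ) < 2 * l then ε * m + j else 0 := by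
    intro c
    push_cast at hj
    split_ifs with hc
    · have h1 : (((W c).filter fun v => ∀ i < j, v ∉ T i).card : ℝ) + j * (q + 1) = m := by
        exact_mod_cast hc1 c hc
      linarith
    · have h1 : (((W c).filter fun v => ∀ i < j, v ∉ T i).card : ℝ) + j * (2 * q + 1) = 2 * m := by
        exact_mod_cast hc2 c hc
      linarith
  have hcardlt : ((Finset.univ.filter fun c : Fin k => (c : ℕ) < 2 * l).card : ℝ) = 2 * l := by
    rw [Fin.card_filter_val_lt, min_eq_right (by omega)]
    push_cast; ring
  have hl : (1 : ℝ) ≤ l := by exact_mod_cast hl1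
  calc _ ≤ ((∑ c : Fin k, ((W c).filter fun v => ∀ i < j, v ∉ T i).card : ℕ) : ℝ) := by
        exact_mod_cast (Finset.card_le_card hsub).trans Finset.card_biUnion_le
    _ ≤ ∑ c : Fin k, (2 * (ε * m) + j - if (c : ℕ) < 2 * l then ε * m + j else 0) := by
        push_cast
        exact Finset.sum_le_sum fun c _ => hbound c
    _ = k * (2 * (ε * m) + j) - 2 * l * (ε * m + j) := by
        rw [Finset.sum_sub_distrib, ← Finset.sum_filter, Finset.sum_const, Finset.sum_const,
          nsmul_eq_mul, nsmul_eq_mul, hcardlt, Finset.card_fin]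
    _ ≤ 2 * k * ε * m := by
        nlinarith [mul_nonneg (sub_nonneg.2 hl) (mul_pos hε hmR).le,
          mul_nonneg (zero_le_one.trans hl) (Nat.cast_nonneg (α := ℝ) j)]
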